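/- Under the uniform local ℓ_p stability assumption and the stated conditions on α and γ, suppose v is a real-valued function on the nonempty compact subsets of D̃ that satisfies v(X) = Ψ(X) + v(F(X)) for all nonempty compact X ⊆ D̃, and that satisfies: for every nonempty compact X, if d_H^a(R(X,k),𝒜) → 0 as k → ∞ then v(R(X,k)) → 0. Then v(X) = V(X) for every nonempty compact X ⊆ D̃ (uniqueness of the solution of the Bellman equation for V). -/

import Mathlib

open Metric Set Filter Topology TopologicalSpace ENNReal

noncomputable section

abbrev Euc (n : ℕ) : Type := EuclideanSpace ℝ (Fin n)

/-- Trajectory of the discrete-time uncertain system `x_{k+1} = f (x_k) (w_k)`. -/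
def traj {n m : ℕ} (f : Euc n → Euc m → Euc n) (x : Euc n) (π : ℕ → Euc m) : ℕ → Euc n
  | 0 => x
  | k + 1 => f (traj f x π k) (π k)

/-- Reachable set of `X` at time `k` under disturbance signals taking values in `W`. -/
def reach {n m : ℕ} (f : Euc n → Euc m → Euc n) (W : Set (Euc m)) (X : Set (Euc n)) (k : ℕ) :
    Set (Euc n) :=
  {y | ∃ x ∈ X, ∃ π : ℕ → Euc m, (∀ j, π j ∈ W) ∧ y = traj f x π k}

/-- The one-step set-valued map `F(X) = {f x w : x ∈ X, w ∈ W}`. -/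
def Fmap {n m : ℕ} (f : Euc n → Euc m → Euc n) (W : Set (Euc m)) (X : Set (Euc n)) :
    Set (Euc n) :=
  Set.image2 f X W

/-- Asymmetric (directed) Hausdorff distance `sup_{x ∈ A} dist(x, B)`. -/
def dHa {n : ℕ} (A B : Set (Euc n)) : ℝ := ⨆ x : A, Metric.infDist (x : Euc n) B

/-- Uniform local ℓ_p stability of the robust invariant set `𝒜` within the safe set `𝒳`. -/
structure LpStable {n m : ℕ} (f : Euc n → Euc m → Euc n) (W : Set (Euc m))
    (𝒳 𝒜 : Set (Euc n)) where
  r : ℝ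
  M : ℝ
  p : ℝ
  lam : ℝ → ℕ → ℝ
  r_pos : 0 < r
  M_ge_one : 1 ≤ M
  p_pos : 0 < p
  lam_nonneg : ∀ s ∈ Set.Icc (0 : ℝ) r, ∀ k : ℕ, 0 ≤ lam s k
  lam_cont : ∀ k : ℕ, ContinuousOn (fun s => lam s k) (Set.Icc (0 : ℝ) r)
  lam_mono : ∀ k : ℕ, MonotoneOn (fun s => lam s k) (Set.Icc (0 : ℝ) r)
  lam_zero : ∀ k : ℕ, lam 0 k = 0
  lam_anti : ∀ s ∈ Set.Icc (0 : ℝ) r, ∀ k l : ℕ, k ≤ l → lam s l ≤ lam s k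
  lam_le_id : ∀ s ∈ Set.Icc (0 : ℝ) r, lam s 0 ≤ s
  lam_summable : Summable fun k : ℕ => lam r k ^ p
  stab : ∀ x ∈ 𝒳, Metric.infDist x 𝒜 ≤ r →
    ∀ π : ℕ → Euc m, (∀ j, π j ∈ W) →
      ∀ k : ℕ, Metric.infDist (traj f x π k) 𝒜 ≤ M * lam (Metric.infDist x 𝒜) k

/-- The safe robust domain of uniform attraction. -/
def DOUA {n m : ℕ} (f : Euc n → Euc m → Euc n) (W : Set (Euc m)) (𝒳 𝒜 : Set (Euc n)) :
    Set (Euc n) :=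
  {x | (∀ k : ℕ, reach f W {x} k ⊆ 𝒳) ∧
    Filter.Tendsto (fun k => dHa (reach f W {x} k) 𝒜) Filter.atTop (nhds 0)}

/-- The safe robust domain of attraction. -/
def DOA {n m : ℕ} (f : Euc n → Euc m → Euc n) (W : Set (Euc m)) (𝒳 𝒜 : Set (Euc n)) :
    Set (Euc n) :=
  {x | ∀ π : ℕ → Euc m, (∀ j, π j ∈ W) →
    (∀ k : ℕ, traj f x π k ∈ 𝒳) ∧
      Filter.Tendsto (fun k => Metric.infDist (traj f x π k) 𝒜) Filter.atTop (nhds 0)}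

/-- `Ψ(X) = (sup_{y∈X} γ y) * (sup_{y∈X} α y)`. -/
def Psi {n : ℕ} (α : Euc n → ℝ) (γ : Euc n → ℝ≥0∞) (X : Set (Euc n)) : ℝ≥0∞ :=
  (⨆ y : X, γ (y : Euc n)) * ENNReal.ofReal (⨆ y : X, α (y : Euc n))

/-- The value function `V(X) = Σ_k Ψ(R(X,k))`. -/
def Vval {n m : ℕ} (f : Euc n → Euc m → Euc n) (W : Set (Euc m)) (α : Euc n → ℝ)
    (γ : Euc n → ℝ≥0∞) (X : Set (Euc n)) : ℝ≥0∞ :=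
  ∑' k : ℕ, Psi α γ (reach f W X k)

/-- `exp(-a)` for `a ∈ [0,∞]`, with `exp(-∞) = 0`. -/
def expNeg (a : ℝ≥0∞) : ℝ := if a = ⊤ then 0 else Real.exp (-a.toReal)

/-- The value function `W(X) = 1 - exp(-V(X))`. -/
def Wval {n m : ℕ} (f : Euc n → Euc m → Euc n) (W : Set (Euc m)) (α : Euc n → ℝ)
    (γ : Euc n → ℝ≥0∞) (X : Set (Euc n)) : ℝ :=
  1 - expNeg (Vval f W α γ X)

/-- `ξ(X) = 1 - exp(-Ψ(X))`. -/
def xival {n : ℕ} (α : Euc n → ℝ) (γ : Euc n → ℝ≥0∞) (X : Set (Euc n)) : ℝ :=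
  1 - expNeg (Psi α γ X)

/-- `β(X) = exp(Ψ(X)) - 1`. -/
def betaval {n : ℕ} (α : Euc n → ℝ) (γ : Euc n → ℝ≥0∞) (X : Set (Euc n)) : ℝ :=
  Real.exp ((Psi α γ X).toReal) - 1

/-- Conditions on `α`: continuous with `α̲ dist(x,𝒜)^p̄ ≤ α(x) ≤ ᾱ dist(x,𝒜)^p̄`. -/
def AlphaHyp {n : ℕ} (𝒜 : Set (Euc n)) (α : Euc n → ℝ) (αlow αup pbar : ℝ) : Prop :=
  Continuous α ∧ 0 < αlow ∧ αlow ≤ αup ∧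
    ∀ x : Euc n, αlow * Metric.infDist x 𝒜 ^ pbar ≤ α x ∧
      α x ≤ αup * Metric.infDist x 𝒜 ^ pbar

/-- Conditions on `γ`: finite, continuous and `≥ γ̲ > 0` on `𝒳`, `= ∞` outside `𝒳`,
blowing up along sequences converging to the boundary of `𝒳`. -/
def GammaHyp {n : ℕ} (𝒳 : Set (Euc n)) (γ : Euc n → ℝ≥0∞) (γlow : ℝ) : Prop :=
  (∀ x ∈ 𝒳, γ x ≠ ⊤) ∧ ContinuousOn γ 𝒳 ∧ 0 < γlow ∧
    (∀ x ∈ 𝒳, ENNReal.ofReal γlow ≤ γ x) ∧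
    (∀ x ∉ 𝒳, γ x = ⊤) ∧
    ∀ (u : ℕ → Euc n) (x : Euc n), x ∈ frontier 𝒳 →
      Filter.Tendsto u Filter.atTop (nhds x) →
      Filter.Tendsto (fun k => γ (u k)) Filter.atTop (nhds ⊤)

section helpers
variable {n m : ℕ} {f : Euc n → Euc m → Euc n} {W : Set (Euc m)}

theorem aux_traj_congr (x : Euc n) (π π' : ℕ → Euc m) (k : ℕ) (h : ∀ j < k, π j = π' j) :
    traj f x π k = traj f x π' k := by
  induction k with
  | zero => rfl
  | succ k ih =>
    simp only [traj]
    rw [ih (fun j hj => h j (by omega)), h k (by omega)]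

theorem aux_reach_zero (hW : W.Nonempty) (X : Set (Euc n)) : reach f W X 0 = X := by
  obtain ⟨w, hw⟩ := hW
  ext y
  constructor
  · rintro ⟨x, hx, π, -, rfl⟩
    exact hx
  · intro hy
    exact ⟨y, hy, fun _ => w, fun _ => hw, rfl⟩

theorem aux_reach_succ (X : Set (Euc n)) (k : ℕ) :
    reach f W X (k+1) = Fmap f W (reach f W X k) := by
  ext y
  constructor
  · rintro ⟨x, hx, π, hπ, rfl⟩
    exact ⟨traj f x π k, ⟨x, hx, π, hπ, rfl⟩, π k, hπ k, rfl⟩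
  · rintro ⟨z, ⟨x, hx, π, hπ, rfl⟩, w, hw, rfl⟩
    refine ⟨x, hx, Function.update π k w, ?_, ?_⟩
    · intro j
      by_cases hj : j = k
      · subst hj; simpa using hw
      · simpa [Function.update_of_ne hj] using hπ j
    · simp only [traj, Function.update_self]
      rw [aux_traj_congr x π (Function.update π k w) k]
      intro j hj
      rw [Function.update_of_ne hj.ne]

theorem aux_reach_add (hW : W.Nonempty) (X : Set (Euc n)) (j k : ℕ) :
    reach f W X (j+k) = reach f W (reach f W X j) k := by
  induction k with
  | zero => rw [aux_reach_zero hW]; rfl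
  | succ k ih => rw [← add_assoc, aux_reach_succ, aux_reach_succ, ih]

theorem aux_reach_mono {X Y : Set (Euc n)} (h : X ⊆ Y) (k : ℕ) :
    reach f W X k ⊆ reach f W Y k := by
  rintro y ⟨x, hx, r⟩
  exact ⟨x, h hx, r⟩

theorem aux_reach_nonempty (hW : W.Nonempty) {X : Set (Euc n)} (h : X.Nonempty) (k : ℕ) :
    (reach f W X k).Nonempty := by
  obtain ⟨x, hx⟩ := h
  obtain ⟨w, hw⟩ := hW
  exact ⟨_, x, hx, fun _ => w, fun _ => hw, rfl⟩

theorem aux_Fmap_compact (hf : Continuous fun p : Euc n × Euc m => f p.1 p.2)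
    (hWc : IsCompact W) {X : Set (Euc n)} (h : IsCompact X) : IsCompact (Fmap f W X) := by
  have := (h.prod hWc).image hf
  rwa [Set.image_prod] at this

theorem aux_reach_compact (hf : Continuous fun p : Euc n × Euc m => f p.1 p.2)
    (hW : W.Nonempty) (hWc : IsCompact W) {X : Set (Euc n)} (h : IsCompact X) (k : ℕ) :
    IsCompact (reach f W X k) := by
  induction k with
  | zero => rwa [aux_reach_zero hW]
  | succ k ih => rw [aux_reach_succ]; exact aux_Fmap_compact hf hWc ih

theorem aux_reach_usc (hf : Continuous fun p : Euc n × Euc m => f p.1 p.2)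
    (hW : W.Nonempty) (hWc : IsCompact W) {X : Set (Euc n)} (h : IsCompact X) (k : ℕ) :
    ∀ U : Set (Euc n), IsOpen U → reach f W X k ⊆ U →
    ∃ O, IsOpen O ∧ X ⊆ O ∧ reach f W O k ⊆ U := by
  induction k with
  | zero =>
    intro U hU hX
    rw [aux_reach_zero hW] at hX
    exact ⟨U, hU, hX, by rw [aux_reach_zero hW]⟩
  | succ k ih =>
    intro U hU hX
    have hK := aux_reach_compact hf hW hWc h k
    have hsub : reach f W X k ×ˢ W ⊆ (fun p : Euc n × Euc m => f p.1 p.2) ⁻¹' U := by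
      rintro ⟨a, b⟩ ⟨ha, hb⟩
      apply hX
      rw [aux_reach_succ]
      exact ⟨a, ha, b, hb, rfl⟩
    obtain ⟨O', T, hO', hT, h1, h2, h3⟩ := generalized_tube_lemma hK hWc (hU.preimage hf) hsub
    obtain ⟨O, hO, hXO, hr⟩ := ih O' hO' h1
    refine ⟨O, hO, hXO, ?_⟩
    rw [aux_reach_succ]
    rintro y ⟨a, ha, b, hb, rfl⟩
    exact h3 (⟨hr ha, h2 hb⟩ : (a, b) ∈ O' ×ˢ T)

theorem aux_dHa_le {A B : Set (Euc n)} (hA : A.Nonempty) {c : ℝ}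
    (h : ∀ x ∈ A, Metric.infDist x B ≤ c) : dHa A B ≤ c := by
  haveI := hA.to_subtype
  exact ciSup_le fun x => h x x.2

theorem aux_le_dHa {A B : Set (Euc n)} (hA : IsCompact A) {x : Euc n} (hx : x ∈ A) :
    Metric.infDist x B ≤ dHa A B := by
  have hb : BddAbove (Set.range fun x : A => Metric.infDist (x : Euc n) B) := by
    have := hA.bddAbove_image (f := fun x => Metric.infDist x B)
      (Metric.continuous_infDist_pt B).continuousOn
    rwa [Set.image_eq_range] at this
  exact le_ciSup hb ⟨x, hx⟩

theorem aux_dHa_nonneg {A B : Set (Euc n)} : 0 ≤ dHa A B :=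
  Real.iSup_nonneg fun _ => Metric.infDist_nonneg

theorem aux_reach_DOUA (hf : Continuous fun p : Euc n × Euc m => f p.1 p.2)
    (hW : W.Nonempty) (hWc : IsCompact W) {𝒳 𝒜 X : Set (Euc n)}
    (hX : X ⊆ DOUA f W 𝒳 𝒜) (j : ℕ) : reach f W X j ⊆ DOUA f W 𝒳 𝒜 := by
  rintro y ⟨x, hx, π, hπ, rfl⟩
  obtain ⟨h1, h2⟩ := hX hx
  have hy : {traj f x π j} ⊆ reach f W {x} j := by
    rintro _ rfl
    exact ⟨x, rfl, π, hπ, rfl⟩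
  have hs : ∀ k, reach f W {traj f x π j} k ⊆ reach f W {x} (j + k) := by
    intro k
    rw [aux_reach_add hW]
    exact aux_reach_mono hy k
  refine ⟨fun k => (hs k).trans (h1 _), ?_⟩
  have h3 : Tendsto (fun k => dHa (reach f W {x} (j + k)) 𝒜) atTop (nhds 0) := by
    have := (tendsto_add_atTop_iff_nat j).2 h2
    simpa [add_comm] using this
  refine squeeze_zero (fun _ => aux_dHa_nonneg) (fun k => ?_) h3
  exact aux_dHa_le (aux_reach_nonempty hW (Set.singleton_nonempty _) k) fun z hz =>
    aux_le_dHa (aux_reach_compact hf hW hWc isCompact_singleton _) (hs k hz)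

theorem aux_sub_safe {𝒳 𝒜 : Set (Euc n)} (hW : W.Nonempty) : DOUA f W 𝒳 𝒜 ⊆ 𝒳 := by
  intro x hx
  have := hx.1 0
  rw [aux_reach_zero hW] at this
  exact this rfl

theorem aux_lam_tendsto {𝒳 𝒜 : Set (Euc n)} (H : LpStable f W 𝒳 𝒜) :
    Tendsto (fun k => H.lam H.r k) atTop (nhds 0) := by
  have h := H.lam_summable.tendsto_atTop_zero
  have h2 := h.rpow_const (p := 1 / H.p) (Or.inr (by have := H.p_pos; positivity))
  rw [Real.zero_rpow (by have := H.p_pos; positivity)] at h2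
  refine h2.congr fun k => ?_
  rw [← Real.rpow_mul (H.lam_nonneg _ ⟨H.r_pos.le, le_rfl⟩ k),
    mul_one_div_cancel H.p_pos.ne', Real.rpow_one]

theorem aux_uniform (hf : Continuous fun p : Euc n × Euc m => f p.1 p.2)
    (hW : W.Nonempty) (hWc : IsCompact W) {𝒳 𝒜 X : Set (Euc n)}
    (H : LpStable f W 𝒳 𝒜) (hXc : IsCompact X) (hXn : X.Nonempty)
    (hX : X ⊆ DOUA f W 𝒳 𝒜) :
    Tendsto (fun k => dHa (reach f W X k) 𝒜) atTop (nhds 0) := by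
  have hr : H.r ∈ Set.Icc (0:ℝ) H.r := ⟨H.r_pos.le, le_rfl⟩
  have hM : 0 ≤ H.M := zero_le_one.trans H.M_ge_one
  have key : ∃ K : ℕ, ∀ x ∈ X, x ∈ X → ∀ k, ∀ y ∈ reach f W {x} (K + k),
      Metric.infDist y 𝒜 ≤ H.M * H.lam H.r k := by
    refine hXc.induction_on (p := fun S => ∃ K : ℕ, ∀ x ∈ S, x ∈ X → ∀ k,
      ∀ y ∈ reach f W {x} (K + k), Metric.infDist y 𝒜 ≤ H.M * H.lam H.r k) ?_ ?_ ?_ ?_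
    · exact ⟨0, fun x hx => hx.elim⟩
    · rintro S T hST ⟨K, hK⟩
      exact ⟨K, fun x hx => hK x (hST hx)⟩
    · rintro S T ⟨K, hK⟩ ⟨L, hL⟩
      refine ⟨K + L, fun x hx hxX k y hy => ?_⟩
      rcases hx with hx | hx
      · refine (hK x hx hxX (L + k) y (by rwa [← add_assoc])).trans ?_
        exact mul_le_mul_of_nonneg_left (H.lam_anti _ hr _ _ (by omega)) hM
      · refine (hL x hx hxX (K + k) y (by rwa [← add_assoc, add_comm L K])).trans ?_
        exact mul_le_mul_of_nonneg_left (H.lam_anti _ hr _ _ (by omega)) hM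
    · intro x hx
      obtain ⟨K, hK⟩ := ((hX hx).2.eventually (gt_mem_nhds H.r_pos)).exists
      have hU : IsOpen {z : Euc n | Metric.infDist z 𝒜 < H.r} :=
        isOpen_lt (Metric.continuous_infDist_pt 𝒜) continuous_const
      obtain ⟨O, hO, hxO, hOr⟩ := aux_reach_usc hf hW hWc (isCompact_singleton (x := x)) K _ hU
        (fun z hz => (aux_le_dHa (aux_reach_compact hf hW hWc isCompact_singleton _) hz).trans_lt hK)
      refine ⟨O, mem_nhdsWithin_of_mem_nhds (hO.mem_nhds (hxO rfl)), K, ?_⟩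
      intro x' hx' hx'X k y hy
      rw [aux_reach_add hW] at hy
      obtain ⟨z, hz, π, hπ, rfl⟩ := hy
      have hz1 : Metric.infDist z 𝒜 < H.r :=
        hOr (aux_reach_mono (Set.singleton_subset_iff.2 hx') K hz)
      refine (H.stab z ((hX hx'X).1 K hz) hz1.le π hπ k).trans ?_
      exact mul_le_mul_of_nonneg_left
        (H.lam_mono k ⟨Metric.infDist_nonneg, hz1.le⟩ hr hz1.le) hM
  obtain ⟨K, hK⟩ := key
  rw [← tendsto_add_atTop_iff_nat K]
  have h0 : Tendsto (fun k => H.M * H.lam H.r k) atTop (nhds 0) := by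
    simpa using (aux_lam_tendsto H).const_mul H.M
  refine squeeze_zero (fun _ => aux_dHa_nonneg) (fun k => ?_) h0
  refine aux_dHa_le (aux_reach_nonempty hW hXn _) ?_
  rintro y ⟨x, hx, π, hπ, rfl⟩
  exact hK x hx hx k _ ⟨x, rfl, π, hπ, by rw [add_comm]⟩

theorem aux_Psi_ne_top {𝒳 X : Set (Euc n)} {α : Euc n → ℝ} {γ : Euc n → ℝ≥0∞} {γlow : ℝ}
    (hγ : GammaHyp 𝒳 γ γlow) (hXc : IsCompact X) (hXn : X.Nonempty) (hX : X ⊆ 𝒳) :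
    Psi α γ X ≠ ⊤ := by
  unfold Psi
  refine ENNReal.mul_ne_top ?_ ENNReal.ofReal_ne_top
  obtain ⟨x, hx, hm⟩ := hXc.exists_isMaxOn hXn (hγ.2.1.mono hX)
  refine ne_top_of_le_ne_top (hγ.1 x (hX hx)) (iSup_le fun y => hm y.2)

end helpers

theorem stmt17 {n m : ℕ}
    (f : Euc n → Euc m → Euc n) (hf : Continuous fun p : Euc n × Euc m => f p.1 p.2)
    (Wd : Set (Euc m)) (hWne : Wd.Nonempty) (hWc : IsCompact Wd)
    (𝒳 : Set (Euc n)) (h𝒳 : IsOpen 𝒳)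
    (𝒜 : Set (Euc n)) (h𝒜ne : 𝒜.Nonempty) (h𝒜c : IsCompact 𝒜) (h𝒜𝒳 : 𝒜 ⊆ 𝒳)
    (h𝒜inv : ∀ x ∈ 𝒜, ∀ w ∈ Wd, f x w ∈ 𝒜)
    (H : LpStable f Wd 𝒳 𝒜)
    (α : Euc n → ℝ) (αlow αup pbar : ℝ) (hα : AlphaHyp 𝒜 α αlow αup pbar)
    (hpbar : H.p ≤ pbar)
    (γ : Euc n → ℝ≥0∞) (γlow : ℝ) (hγ : GammaHyp 𝒳 γ γlow)
    (v : Set (Euc n) → ℝ)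
    (hv : ∀ X : Set (Euc n), X.Nonempty → IsCompact X → X ⊆ DOUA f Wd 𝒳 𝒜 →
      v X = (Psi α γ X).toReal + v (Fmap f Wd X))
    (hlim : ∀ X : Set (Euc n), X.Nonempty → IsCompact X →
      Filter.Tendsto (fun k => dHa (reach f Wd X k) 𝒜) Filter.atTop (nhds 0) →
      Filter.Tendsto (fun k => v (reach f Wd X k)) Filter.atTop (nhds 0)) :
    ∀ X : Set (Euc n), X.Nonempty → IsCompact X → X ⊆ DOUA f Wd 𝒳 𝒜 →
      Vval f Wd α γ X ≠ ⊤ ∧ v X = (Vval f Wd α γ X).toReal := by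
  intro X hXn hXc hX
  have hfin : ∀ k, Psi α γ (reach f Wd X k) ≠ ⊤ := fun k =>
    aux_Psi_ne_top hγ (aux_reach_compact hf hWne hWc hXc k) (aux_reach_nonempty hWne hXn k)
      ((aux_reach_DOUA hf hWne hWc hX k).trans (aux_sub_safe hWne))
  have hpart : ∀ N, ∑ k ∈ Finset.range N, (Psi α γ (reach f Wd X k)).toReal
      = v X - v (reach f Wd X N) := by
    intro N
    induction N with
    | zero => simp [aux_reach_zero hWne]
    | succ N ih =>
      rw [Finset.sum_range_succ, ih, hv (reach f Wd X N) (aux_reach_nonempty hWne hXn N)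
        (aux_reach_compact hf hWne hWc hXc N) (aux_reach_DOUA hf hWne hWc hX N),
        aux_reach_succ]
      ring
  have hl := hlim X hXn hXc (aux_uniform hf hWne hWc H hXc hXn hX)
  have hs : HasSum (fun k => (Psi α γ (reach f Wd X k)).toReal) (v X) := by
    rw [hasSum_iff_tendsto_nat_of_nonneg (fun _ => ENNReal.toReal_nonneg)]
    simp_rw [hpart]
    simpa using hl.const_sub (v X)
  have hV : Vval f Wd α γ X = ENNReal.ofReal (v X) := by
    unfold Vval
    rw [← hs.tsum_eq, ENNReal.ofReal_tsum_of_nonneg (fun _ => ENNReal.toReal_nonneg) hs.summable]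
    exact tsum_congr fun k => (ENNReal.ofReal_toReal (hfin k)).symm
  rw [hV]
  exact ⟨ENNReal.ofReal_ne_top,
    (ENNReal.toReal_ofReal (hs.nonneg fun _ => ENNReal.toReal_nonneg)).symm⟩


end
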